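/- arXiv:2601.17322 — 2 statements merged into one kernel-verified Lean document; each statement's English description precedes it below -/
import Mathlib

section
/- Ready trace inclusion implies failure trace inclusion: if every ready trace of s0 is a ready trace of t0, then every failure trace of s0 is a failure trace of t0. -/
variable {S L P : Type}

/-- `initial s`: the set of labels of outgoing transitions of `s` together with
the predicates satisfied by `s`. -/
def initialSet (tr : S → L → S → Prop) (sat : S → P → Prop) (s : S) : Set (L ⊕ P) :=
  {x | Sum.elim (fun U => ∃ s', tr s U s') (fun Q => sat s Q) x}

/-- `ReadyTrace tr sat s X l` holds when `X (U₁, X₁) ⋯ (Uₙ, Xₙ)` (with `l = [(U₁,X₁),…,(Uₙ,Xₙ)]`)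
is a ready trace of `s`: there is a path `s —U₁→ s₁ —U₂→ ⋯ —Uₙ→ sₙ` with `X = initial s`
and `Xᵢ = initial sᵢ`. -/
inductive ReadyTrace (tr : S → L → S → Prop) (sat : S → P → Prop) :
    S → Set (L ⊕ P) → List (L × Set (L ⊕ P)) → Prop
  | nil (s : S) : ReadyTrace tr sat s (initialSet tr sat s) []
  | cons {s s' : S} {U : L} {X : Set (L ⊕ P)} {l : List (L × Set (L ⊕ P))} :
      tr s U s' → ReadyTrace tr sat s' X l →
      ReadyTrace tr sat s (initialSet tr sat s) ((U, X) :: l)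

/-- A path along a list of labels in a labelled transition relation. -/
inductive TrPath {S α : Type} (step : S → α → S → Prop) : S → List α → S → Prop
  | nil (s : S) : TrPath step s [] s
  | cons {s s' s'' : S} {a : α} {l : List α} :
      step s a s' → TrPath step s' l s'' → TrPath step s (a :: l) s''

/-- The extended transition relation used to define failure traces: besides the original
transitions, each state `s` has a self-loop labelled by any refusal set `X ⊆ L ⊕ P`
with `initial s ∩ X = ∅`. -/
def extStep (tr : S → L → S → Prop) (sat : S → P → Prop)
    (s : S) (v : L ⊕ Set (L ⊕ P)) (s' : S) : Prop :=
  Sum.elim (fun U => tr s U s') (fun X => s' = s ∧ initialSet tr sat s ∩ X = ∅) v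

/-- `ς` is a failure trace of `s₀`. -/
def FailureTrace (tr : S → L → S → Prop) (sat : S → P → Prop)
    (s0 : S) (ς : List (L ⊕ Set (L ⊕ P))) : Prop :=
  ∃ s1, TrPath (extStep tr sat) s0 ς s1

theorem exists_readyTrace_witness (tr : S → L → S → Prop) (sat : S → P → Prop)
    {s s1 : S} {ς : List (L ⊕ Set (L ⊕ P))} (hp : TrPath (extStep tr sat) s ς s1) :
    ∃ X l, ReadyTrace tr sat s X l ∧ ∀ t, ReadyTrace tr sat t X l → FailureTrace tr sat t ς := by
  induction hp with
  | nil s => exact ⟨_, _, ReadyTrace.nil s, fun t _ => ⟨t, TrPath.nil t⟩⟩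
  | @cons s s' s'' a ς hstep _ ih =>
    obtain ⟨X, l, hr, hf⟩ := ih
    cases a with
    | inl U =>
      refine ⟨_, _, ReadyTrace.cons (show tr s U s' from hstep) hr, fun t ht => ?_⟩
      generalize initialSet tr sat s = Y at ht
      cases ht with
      | cons htr hrest =>
        obtain ⟨t1, h1⟩ := hf _ hrest
        exact ⟨t1, TrPath.cons (show extStep tr sat t (Sum.inl U) _ from htr) h1⟩
    | inr Z =>
      obtain ⟨rfl, hZ⟩ : s' = s ∧ initialSet tr sat s ∩ Z = ∅ := hstep
      refine ⟨X, l, hr, fun t ht => ?_⟩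
      obtain ⟨t1, h1⟩ := hf t ht
      have e1 : X = initialSet tr sat s' := by cases hr <;> rfl
      have e2 : X = initialSet tr sat t := by cases ht <;> rfl
      rw [← e1, e2] at hZ
      exact ⟨t1, TrPath.cons (show extStep tr sat t (Sum.inr Z) t from ⟨rfl, hZ⟩) h1⟩

/-- Ready trace inclusion implies failure trace inclusion. -/
theorem readyTrace_incl_imp_failureTrace_incl (tr : S → L → S → Prop) (sat : S → P → Prop)
    (s0 t0 : S)
    (h : ∀ (X : Set (L ⊕ P)) (l : List (L × Set (L ⊕ P))),
      ReadyTrace tr sat s0 X l → ReadyTrace tr sat t0 X l) :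
    ∀ ς : List (L ⊕ Set (L ⊕ P)), FailureTrace tr sat s0 ς → FailureTrace tr sat t0 ς := by
  rintro ς ⟨s1, hp⟩
  obtain ⟨X, l, hr, hf⟩ := exists_readyTrace_witness tr sat hp
  exact hf t0 (h X l hr)
end

section
/- Ground confluence of extended term rewrite systems (abstract form): let α be a type, let →0 and → be binary relations on α with →0 contained in →, let →* and →0* denote their reflexive-transitive closures, let ∼ be an equivalence relation on α, and let T0 be a subset of α. Assume (1) soundness: x →* y implies x ∼ y for all x, y ∈ α; (2) for all t, t' ∈ T0 with t ∼ t' there is u ∈ T0 with t →0* u and t' →0* u; (3) for every t ∈ α there is t' ∈ T0 with t →* t'. Then → is confluent on α: whenever t →* t0 and t →* t1 there is u with t0 →* u and t1 →* u. (Instantiating α as the closed terms T(Σ0 ⊕ Σ1), → as the rewrite relation induced by the term rewrite system R0 ⊕ R1, →0 as the rewrite relation induced by R0, and T0 as T(Σ0) yields the paper's theorem that R0 ⊕ R1 is ground confluent over T(Σ0 ⊕ Σ1).) -/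
/-- Ground confluence of extended term rewrite systems (abstract form): if `→` is
sound modulo an equivalence `∼`, any two `∼`-equivalent elements of `T0` have a
common `→0`-reduct in `T0` (where `→0 ⊆ →`), and every element reduces via `→`
to an element of `T0`, then `→` is confluent. -/
theorem ground_confluence_of_extension {α : Type*} (r0 r : α → α → Prop)
    (hsub : ∀ a b, r0 a b → r a b)
    (sim : α → α → Prop) (hequiv : Equivalence sim) (T0 : Set α)
    (hsound : ∀ x y, Relation.ReflTransGen r x y → sim x y)
    (hjoin : ∀ t ∈ T0, ∀ t' ∈ T0, sim t t' →
      ∃ u ∈ T0, Relation.ReflTransGen r0 t u ∧ Relation.ReflTransGen r0 t' u)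
    (hred : ∀ t : α, ∃ t' ∈ T0, Relation.ReflTransGen r t t') :
    ∀ t t0 t1 : α, Relation.ReflTransGen r t t0 → Relation.ReflTransGen r t t1 →
      ∃ u, Relation.ReflTransGen r t0 u ∧ Relation.ReflTransGen r t1 u := by
  intro t t0 t1 h0 h1
  obtain ⟨a, ha, h0a⟩ := hred t0
  obtain ⟨b, hb, h1b⟩ := hred t1
  have hab : sim a b :=
    hequiv.trans (hequiv.symm (hsound _ _ (h0.trans h0a))) (hsound _ _ (h1.trans h1b))
  obtain ⟨u, _, hau, hbu⟩ := hjoin a ha b hb hab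
  exact ⟨u, h0a.trans (Relation.ReflTransGen.mono hsub _ _ hau), h1b.trans (Relation.ReflTransGen.mono hsub _ _ hbu)⟩
end
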